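/- For fixed integer k ≥ 1, the quantity ψ^max_{1,k}(n) grows like Θ(n^{4⌈k/2⌉−2}): there exist constants c_1, c_2 > 0 (depending only on k) such that c_1 n^{4⌈k/2⌉−2} ≤ ψ^max_{1,k}(n) ≤ c_2 n^{4⌈k/2⌉−2} for all sufficiently large n. -/

import Mathlib

/-- `sumDist V x = Σ_{v ∈ V} ‖x − v‖` (with multiplicity): the sum of Euclidean
distances from `x` to the points of the multiset `V`. -/
noncomputable def sumDist {d : ℕ} (V : Multiset (EuclideanSpace ℝ (Fin d)))
    (x : EuclideanSpace ℝ (Fin d)) : ℝ :=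
  (V.map fun v => dist x v).sum

/-- `PsiSet k n C` is the set of orderings `Σ_V^C` of the `n`-element set `C ⊆ ℝ^d`,
recorded as injective enumerations `σ : Fin n → ℝ^d` of `C`, witnessed by some
`k`-element multiset `V` of vantage points which distinguishes the points of `C`
(i.e. `D_V` is injective on `C`) and along which `D_V` is strictly increasing. -/
def PsiSet {d : ℕ} (k n : ℕ) (C : Finset (EuclideanSpace ℝ (Fin d))) :
    Set (Fin n → EuclideanSpace ℝ (Fin d)) :=
  {σ | Function.Injective σ ∧ (∀ i, σ i ∈ C) ∧
    ∃ V : Multiset (EuclideanSpace ℝ (Fin d)), Multiset.card V = k ∧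
      Set.InjOn (sumDist V) ↑C ∧ StrictMono fun i => sumDist V (σ i)}

/-- `ψ_k(C)`, the number of orderings of `C` witnessed by `k`-element multisets. -/
noncomputable def psiCount {d : ℕ} (k : ℕ) (C : Finset (EuclideanSpace ℝ (Fin d))) : ℕ :=
  Nat.card (PsiSet k C.card C)

/-- `ψ^max_{d,k}(n)`: the maximum of `ψ_k(C)` over all `n`-element sets `C ⊆ ℝ^d`. -/
noncomputable def psiMax (d k n : ℕ) : ℕ :=
  sSup {m | ∃ C : Finset (EuclideanSpace ℝ (Fin d)), C.card = n ∧ psiCount k C = m}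

theorem vcDim_affine_le {ι : Type*} [DecidableEq ι] {p : ℕ} (f : ι → Fin p → ℝ) (b : ι → ℝ)
    (𝒜 : Finset (Finset ι))
    (h𝒜 : ∀ A ∈ 𝒜, ∃ x : Fin p → ℝ, ∀ i, i ∈ A ↔ 0 < f i ⬝ᵥ x + b i) :
    𝒜.vcDim ≤ p := by
  refine Finset.sup_le fun s hs => ?_
  rw [Finset.mem_shatterer] at hs
  have key : ∀ g : s → ℝ, ∑ i, g i • f i = 0 →
      0 ≤ ∑ i, g i * b i ∧ ∀ i, 0 < g i → 0 < ∑ i, g i * b i := by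
    intro g hg
    obtain ⟨A, hA, hsA⟩ := hs (t := (Finset.univ.filter fun i => 0 < g i).map
      (Function.Embedding.subtype _)) (by
        intro i hi
        obtain ⟨j, -, rfl⟩ := Finset.mem_map.1 hi
        exact j.2)
    obtain ⟨x, hx⟩ := h𝒜 A hA
    have hmem : ∀ i : s, 0 < f i ⬝ᵥ x + b i ↔ 0 < g i := by
      intro i
      rw [← hx]
      have : (i : ι) ∈ s ∩ A ↔ 0 < g i := by simp [hsA]
      rw [← this, Finset.mem_inter]
      simp [i.2]
    have hsum : ∑ i, g i * b i = ∑ i, g i * (f i ⬝ᵥ x + b i) := by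
      have h0 : (∑ i, g i • f i) ⬝ᵥ x = 0 := by rw [hg, zero_dotProduct]
      rw [sum_dotProduct] at h0
      simp only [smul_dotProduct, smul_eq_mul] at h0
      simp only [mul_add, Finset.sum_add_distrib, h0, zero_add]
    have hnn : ∀ i ∈ Finset.univ, 0 ≤ g i * (f i ⬝ᵥ x + b i) := by
      intro i _
      rcases lt_or_ge 0 (g i) with h | h
      · exact (mul_pos h ((hmem i).2 h)).le
      · exact mul_nonneg_of_nonpos_of_nonpos h (not_lt.1 fun h' => not_lt.2 h ((hmem i).1 h'))
    rw [hsum]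
    exact ⟨Finset.sum_nonneg hnn, fun i hi =>
      Finset.sum_pos' hnn ⟨i, Finset.mem_univ i, mul_pos hi ((hmem i).2 hi)⟩⟩
  by_contra hcard
  have hdep : ¬ LinearIndependent ℝ (fun i : s => f i) := by
    intro h
    have := h.fintype_card_le_finrank
    simp at this
    omega
  obtain ⟨g, hg, i, hi⟩ := Fintype.not_linearIndependent_iff.1 hdep
  have h1 := key g hg
  have h2 := key (-g) (by simpa using hg)
  simp only [Pi.neg_apply, neg_mul, Finset.sum_neg_distrib] at h2
  rcases lt_or_gt_of_ne hi with h | h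
  · linarith [h2.2 i (by linarith), h1.1]
  · linarith [h1.2 i h, h2.1]

theorem card_affine_patterns_le {ι : Type*} [Fintype ι] [DecidableEq ι] [Nonempty ι] {p : ℕ}
    (f : ι → Fin p → ℝ) (b : ι → ℝ) (𝒜 : Finset (Finset ι))
    (h𝒜 : ∀ A ∈ 𝒜, ∃ x : Fin p → ℝ, ∀ i, i ∈ A ↔ 0 < f i ⬝ᵥ x + b i) :
    𝒜.card ≤ (p + 1) * Fintype.card ι ^ p := by
  calc 𝒜.card ≤ 𝒜.shatterer.card := Finset.card_le_card_shatterer 𝒜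
    _ ≤ ∑ j ∈ Finset.Iic 𝒜.vcDim, (Fintype.card ι).choose j := Finset.card_shatterer_le_sum_vcDim
    _ ≤ ∑ j ∈ Finset.Iic p, (Fintype.card ι).choose j :=
        Finset.sum_le_sum_of_subset (Finset.Iic_subset_Iic.2 (vcDim_affine_le f b 𝒜 h𝒜))
    _ ≤ ∑ _j ∈ Finset.Iic p, Fintype.card ι ^ p := by
        refine Finset.sum_le_sum fun j hj => (Nat.choose_le_pow _ _).trans ?_
        exact Nat.pow_le_pow_right Fintype.card_pos (Finset.mem_Iic.1 hj)
    _ = (p + 1) * Fintype.card ι ^ p := by simp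

/-- The sum of distances on the line to `p` points `v a`, taken with multiplicities `ω a`. -/
noncomputable def weightedDist (p : ℕ) (ω : ℕ → ℕ) (v : ℕ → ℝ) (x : ℝ) : ℝ :=
  ∑ a ∈ Finset.range p, ω a * |x - v a|

theorem Multiset.exists_sum_range_abs_sub (W : Multiset ℝ) :
    ∃ u : ℕ → ℝ, ∀ x, (W.map fun v => |x - v|).sum
      = ∑ a ∈ Finset.range (Multiset.card W), |x - u a| := by
  induction W using Multiset.induction with
  | empty => exact ⟨0, by simp⟩
  | cons s W ih =>
    obtain ⟨u, hu⟩ := ih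
    refine ⟨fun a => Nat.casesOn a s u, fun x => ?_⟩
    rw [Multiset.card_cons, Finset.sum_range_succ']
    simp [hu, add_comm]

theorem Multiset.exists_median_pair (m : ℕ) : ∀ V : Multiset ℝ, Multiset.card V = 2 * m + 2 →
    ∃ a b W, V = a ::ₘ b ::ₘ W ∧ a ≤ b ∧ ∀ x ∈ Set.Icc a b, ∀ y,
      (V.map fun v => |x - v|).sum ≤ (V.map fun v => |y - v|).sum := by
  have pair : ∀ a b x y : ℝ, x ∈ Set.Icc a b → |x - a| + |x - b| ≤ |y - a| + |y - b| := by
    intro a b x y hx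
    rw [abs_of_nonneg (sub_nonneg.2 hx.1), abs_of_nonpos (sub_nonpos.2 hx.2)]
    linarith [le_abs_self (y - a), neg_abs_le (y - b)]
  induction m with
  | zero =>
    intro V hV
    obtain ⟨a, b, rfl⟩ := Multiset.card_eq_two.1 hV
    rcases le_total a b with h | h
    · exact ⟨a, b, 0, rfl, h, fun x hx y => by simpa using pair a b x y hx⟩
    · exact ⟨b, a, 0, Multiset.pair_comm a b, h, fun x hx y => by
        simpa [add_comm] using pair b a x y hx⟩
  | succ m ih =>
    intro V hV
    obtain ⟨lo, hlo, hlo'⟩ := V.toFinset.exists_min_image id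
      ⟨_, Multiset.mem_toFinset.2 (Multiset.card_pos_iff_exists_mem.1 (by omega)).choose_spec⟩
    obtain ⟨V₁, rfl⟩ := Multiset.exists_cons_of_mem (Multiset.mem_toFinset.1 hlo)
    rw [Multiset.card_cons] at hV
    obtain ⟨hi, hhi, hhi'⟩ := V₁.toFinset.exists_max_image id
      ⟨_, Multiset.mem_toFinset.2 (Multiset.card_pos_iff_exists_mem.1 (by omega)).choose_spec⟩
    obtain ⟨V₂, rfl⟩ := Multiset.exists_cons_of_mem (Multiset.mem_toFinset.1 hhi)
    rw [Multiset.card_cons] at hV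
    obtain ⟨a, b, W, rfl, hab, hmin⟩ := ih V₂ (by omega)
    refine ⟨a, b, lo ::ₘ hi ::ₘ W, ?_, hab, fun x hx y => ?_⟩
    · simp only [← Multiset.singleton_add]; abel
    · have h1 : lo ≤ a := hlo' a (by simp)
      have h2 : b ≤ hi := hhi' b (by simp)
      have h3 := pair lo hi x y ⟨h1.trans hx.1, hx.2.trans h2⟩
      have h4 := hmin x hx y
      simp only [Multiset.map_cons, Multiset.sum_cons] at h4 ⊢
      linarith

/-- The multiplicities of the `2 * r + 1` points to which `k` vantage points can be reduced. -/
def medianWeight (k r a : ℕ) : ℕ := if a = 0 then k - 2 * r else 1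

theorem weightedDist_medianWeight (k r : ℕ) (v : ℕ → ℝ) (x : ℝ) :
    weightedDist (2 * r + 1) (medianWeight k r) v x
      = ∑ a ∈ Finset.range (2 * r), |x - v (a + 1)| + (k - 2 * r : ℕ) * |x - v 0| := by
  simp [weightedDist, Finset.sum_range_succ', medianWeight]

theorem exists_weightedDist_lt {k r : ℕ} (hk : k = 2 * r + 1 ∨ k = 2 * r + 2) (V : Multiset ℝ)
    (hV : Multiset.card V = k) :
    ∃ v : ℕ → ℝ, ∀ x y,
      (V.map fun v => |x - v|).sum < (V.map fun v => |y - v|).sum →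
      weightedDist (2 * r + 1) (medianWeight k r) v x
        < weightedDist (2 * r + 1) (medianWeight k r) v y := by
  rcases hk with rfl | rfl
  · obtain ⟨s, hs⟩ := Multiset.card_pos_iff_exists_mem.1 (show 0 < Multiset.card V by omega)
    obtain ⟨W, rfl⟩ := Multiset.exists_cons_of_mem hs
    obtain ⟨u, hu⟩ := W.exists_sum_range_abs_sub
    have hW : Multiset.card W = 2 * r := by simpa using hV
    rw [hW] at hu
    refine ⟨fun i => if i = 0 then s else u (i - 1), fun x y h => ?_⟩
    simp only [Multiset.map_cons, Multiset.sum_cons, hu] at h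
    simp only [weightedDist_medianWeight, Nat.add_sub_cancel_left, Nat.cast_one, if_true,
      Nat.add_sub_cancel, Nat.add_eq_zero_iff, one_ne_zero, and_false, if_false]
    linarith
  · obtain ⟨a, b, W, rfl, hab, hmin⟩ := V.exists_median_pair r hV
    obtain ⟨u, hu⟩ := W.exists_sum_range_abs_sub
    have hW : Multiset.card W = 2 * r := by simpa using hV
    rw [hW] at hu
    refine ⟨fun i => if i = 0 then (a + b) / 2 else u (i - 1), fun x y h => ?_⟩
    have hle : ∀ t, 2 * |t - (a + b) / 2| ≤ |t - a| + |t - b| := by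
      intro t
      have := abs_add_le (t - a) (t - b)
      rwa [show t - a + (t - b) = 2 * (t - (a + b) / 2) by ring, abs_mul, abs_two] at this
    have hy' : y ∉ Set.Icc a b := fun hy' => not_lt.2 (hmin y hy' x) h
    have heq : |y - a| + |y - b| = 2 * |y - (a + b) / 2| := by
      rw [Set.mem_Icc, not_and_or, not_le, not_le] at hy'
      rcases hy' with h | h
      · rw [abs_of_neg, abs_of_neg, abs_of_neg] <;> linarith
      · rw [abs_of_pos, abs_of_pos, abs_of_pos] <;> linarith
    simp only [Multiset.map_cons, Multiset.sum_cons, hu] at h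
    simp only [weightedDist_medianWeight, Nat.add_sub_cancel_left, Nat.cast_ofNat, if_true,
      Nat.add_sub_cancel, Nat.add_eq_zero_iff, one_ne_zero, and_false, if_false]
    linarith [hle x]

theorem dist_eq_abs_apply_zero (x y : EuclideanSpace ℝ (Fin 1)) : dist x y = |x 0 - y 0| := by
  simp [EuclideanSpace.dist_eq, Real.dist_eq, Real.sqrt_sq_eq_abs]

theorem sumDist_eq_sum_abs (V : Multiset (EuclideanSpace ℝ (Fin 1)))
    (x : EuclideanSpace ℝ (Fin 1)) :
    sumDist V x = ((V.map fun v => v 0).map fun v => |x 0 - v|).sum := by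
  simp only [sumDist, Multiset.map_map, Function.comp_def, dist_eq_abs_apply_zero]

theorem psiSet_finite {d : ℕ} (k n : ℕ) (C : Finset (EuclideanSpace ℝ (Fin d))) :
    (PsiSet k n C).Finite :=
  (Set.Finite.pi fun _ => C.finite_toSet).subset fun _ hσ => Set.mem_univ_pi.2 hσ.2.1

/-- An affine functional in `v`, agreeing with `weightedDist p ω v x - weightedDist p ω v y`
when `s` and `t` record which points `v a` exceed `x` and `y`. -/
theorem weightedDist_sub_eq (p : ℕ) (ω : ℕ → ℕ) (v : ℕ → ℝ) (x y : ℝ) (s t : Fin p → Bool)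
    (hs : ∀ a : Fin p, s a = true ↔ 0 < v a - x) (ht : ∀ a : Fin p, t a = true ↔ 0 < v a - y) :
    weightedDist p ω v x - weightedDist p ω v y =
      (fun a : Fin p => (ω a : ℝ) * ((if s a then 1 else -1) - (if t a then 1 else -1)))
        ⬝ᵥ (fun a : Fin p => v a)
      + ∑ a : Fin p, (ω a : ℝ) * ((if t a then 1 else -1) * y - (if s a then 1 else -1) * x) := by
  have habs : ∀ (z : ℝ) (u : Fin p → Bool) (_ : ∀ a : Fin p, u a = true ↔ 0 < v a - z) (a : Fin p),
      |z - v a| = (if u a then 1 else -1) * (v a - z) := by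
    intro z u hu a
    rw [abs_sub_comm]
    split_ifs with h
    · rw [abs_of_pos ((hu a).1 h), one_mul]
    · rw [abs_of_nonpos (not_lt.1 fun h' => h ((hu a).2 h'))]; ring
  rw [weightedDist, weightedDist, Finset.sum_range, Finset.sum_range, ← Finset.sum_sub_distrib,
    dotProduct, ← Finset.sum_add_distrib]
  refine Finset.sum_congr rfl fun a _ => ?_
  rw [habs x s hs a, habs y t ht a]
  ring

theorem Function.Injective.exists_eq_of_mem_finset {α : Type*} {C : Finset α}
    {σ : Fin C.card → α} (hσ : Function.Injective σ) (hσC : ∀ i, σ i ∈ C) {c : α} (hc : c ∈ C) :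
    ∃ i, σ i = c := by
  obtain ⟨i, -, hi⟩ := Finset.surj_on_of_inj_on_of_card_le (s := Finset.univ) (t := C)
    (fun i _ => σ i) (fun i _ => hσC i) (fun i j _ _ h => hσ h) (by simp) c hc
  exact ⟨i, hi.symm⟩

theorem psiCount_le {k r : ℕ} (hk : k = 2 * r + 1 ∨ k = 2 * r + 2)
    (C : Finset (EuclideanSpace ℝ (Fin 1))) (hC : C.Nonempty) :
    psiCount k C ≤ (2 * r + 2) *
      ((2 * r + 1 + 4 ^ (2 * r + 1)) * C.card ^ 2) ^ (2 * r + 1) := by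
  classical
  set p := 2 * r + 1 with hp
  set ω := medianWeight k r
  let ι := (Fin p × C) ⊕ (C × C × (Fin p → Bool) × (Fin p → Bool))
  let sg : Bool → ℝ := fun s => if s then 1 else -1
  let f : ι → Fin p → ℝ := Sum.elim (fun i => Pi.single i.1 1)
    fun i a => ω a * (sg (i.2.2.1 a) - sg (i.2.2.2 a))
  let b : ι → ℝ := Sum.elim (fun i => -(i.2 : EuclideanSpace ℝ (Fin 1)) 0)
    fun i => ∑ a : Fin p, ω a * (sg (i.2.2.2 a) * (i.2.1 : EuclideanSpace ℝ (Fin 1)) 0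
      - sg (i.2.2.1 a) * (i.1 : EuclideanSpace ℝ (Fin 1)) 0)
  let pat : (ℕ → ℝ) → Finset ι := fun v =>
    Finset.univ.filter fun i => 0 < f i ⬝ᵥ (fun a : Fin p => v a) + b i
  have hpat : ∀ v v', pat v = pat v' → ∀ x ∈ C, ∀ y ∈ C,
      weightedDist p ω v (y 0) < weightedDist p ω v (x 0) →
      weightedDist p ω v' (y 0) < weightedDist p ω v' (x 0) := by
    intro v v' hvv x hx y hy hlt
    have hiff : ∀ i, 0 < f i ⬝ᵥ (fun a : Fin p => v a) + b i ↔
        0 < f i ⬝ᵥ (fun a : Fin p => v' a) + b i := by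
      intro i
      simpa [pat] using Finset.ext_iff.1 hvv i
    have hcell : ∀ z ∈ C, ∀ a : Fin p, 0 < v a - z 0 ↔ 0 < v' a - z 0 := by
      intro z hz a
      simpa [f, b, sub_eq_add_neg] using hiff (Sum.inl (a, ⟨z, hz⟩))
    let s : Fin p → Bool := fun a => decide (0 < v a - x 0)
    let t : Fin p → Bool := fun a => decide (0 < v a - y 0)
    have h := hiff (Sum.inr (⟨x, hx⟩, ⟨y, hy⟩, s, t))
    have e1 := weightedDist_sub_eq p ω v (x 0) (y 0) s t (by simp [s]) (by simp [t])
    have e2 := weightedDist_sub_eq p ω v' (x 0) (y 0) s t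
      (by simpa [s] using hcell x hx) (by simpa [t] using hcell y hy)
    rw [← sub_pos, e1] at hlt
    rw [← sub_pos, e2]
    exact h.1 hlt
  let 𝒜 : Finset (Finset ι) := Finset.univ.filter fun A => ∃ v, pat v = A
  have hne : Nonempty ι := ⟨Sum.inl (⟨0, by omega⟩, ⟨_, hC.choose_spec⟩)⟩
  have hcard : 𝒜.card ≤ (p + 1) * Fintype.card ι ^ p := by
    refine card_affine_patterns_le f b 𝒜 fun A hA => ?_
    obtain ⟨v, rfl⟩ := (Finset.mem_filter.1 hA).2
    exact ⟨fun a => v a, fun i => by simp [pat]⟩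
  have hι : Fintype.card ι ≤ (p + 4 ^ p) * C.card ^ 2 := by
    have h4 : (4 : ℕ) ^ p = 2 ^ p * 2 ^ p := by rw [← mul_pow]; norm_num
    have h1 : p * C.card ≤ p * C.card ^ 2 :=
      Nat.mul_le_mul_left _ (Nat.le_self_pow two_ne_zero _)
    simp only [ι, Fintype.card_sum, Fintype.card_prod, Fintype.card_fin, Fintype.card_coe,
      Fintype.card_fun, Fintype.card_bool]
    rw [h4]
    nlinarith
  have hex : ∀ σ : PsiSet k C.card C, ∃ v : ℕ → ℝ,
      StrictMono fun i => weightedDist p ω v ((σ : Fin C.card → EuclideanSpace ℝ (Fin 1)) i 0) := by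
    rintro ⟨σ, -, -, V, hV, -, hmono⟩
    obtain ⟨v, hv⟩ := exists_weightedDist_lt hk (V.map fun v => v 0) (by simpa using hV)
    refine ⟨v, fun i j hij => hv _ _ ?_⟩
    rw [← sumDist_eq_sum_abs, ← sumDist_eq_sum_abs]
    exact hmono hij
  choose v hv using hex
  have hinj : Function.Injective fun σ : PsiSet k C.card C =>
      (⟨pat (v σ), by simp [𝒜]⟩ : 𝒜) := by
    intro σ τ hστ
    have hpeq : pat (v σ) = pat (v τ) := congrArg Subtype.val hστ
    have hsurj : ∀ ρ : PsiSet k C.card C, ∀ c ∈ C, ∃ i, ρ.1 i = c := fun ρ _ hc =>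
      ρ.2.1.exists_eq_of_mem_finset ρ.2.2.1 hc
    have hmono : StrictMono fun i => weightedDist p ω (v τ) (σ.1 i 0) :=
      fun i j hij => hpat _ _ hpeq _ (σ.2.2.1 j) _ (σ.2.2.1 i) (hv σ hij)
    have hrange : ∀ ρ : PsiSet k C.card C,
        Set.range (fun i => weightedDist p ω (v τ) ((ρ.1 i : EuclideanSpace ℝ (Fin 1)) 0))
          = (fun c => weightedDist p ω (v τ) ((c : EuclideanSpace ℝ (Fin 1)) 0)) '' C := by
      intro ρ
      ext y
      constructor
      · rintro ⟨i, rfl⟩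
        exact ⟨_, ρ.2.2.1 i, rfl⟩
      · rintro ⟨c, hc, rfl⟩
        obtain ⟨i, rfl⟩ := hsurj ρ c hc
        exact ⟨i, rfl⟩
    have heq := (hmono.range_inj (hv τ)).1 ((hrange σ).trans (hrange τ).symm)
    refine Subtype.ext (funext fun i => ?_)
    obtain ⟨j, hj⟩ := hsurj τ _ (σ.2.2.1 i)
    have h1 := congrFun heq i
    simp only [← hj] at h1
    rw [← hj, (hv τ).injective h1]
  calc psiCount k C ≤ Nat.card 𝒜 := Nat.card_le_card_of_injective _ hinj
    _ = 𝒜.card := by simp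
    _ ≤ (p + 1) * Fintype.card ι ^ p := hcard
    _ ≤ _ := Nat.mul_le_mul_left _ (Nat.pow_le_pow_left hι p)

theorem weightedDist_convexOn (p : ℕ) (ω : ℕ → ℕ) (v : ℕ → ℝ) :
    ConvexOn ℝ Set.univ (weightedDist p ω v) := by
  have h : ∀ s : Finset ℕ, ConvexOn ℝ Set.univ fun x => ∑ a ∈ s, (ω a : ℝ) * |x - v a| := by
    intro s
    induction s using Finset.induction_on with
    | empty => simpa using convexOn_const (0 : ℝ) convex_univ
    | insert a s ha ih =>
      simp only [Finset.sum_insert ha]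
      refine ConvexOn.add ?_ ih
      simpa [Real.dist_eq] using (convexOn_univ_dist (v a)).smul (Nat.cast_nonneg (α := ℝ) (ω a))
  exact h _

theorem weightedDist_continuous (p : ℕ) (ω : ℕ → ℕ) (v : ℕ → ℝ) :
    Continuous (weightedDist p ω v) := by
  unfold weightedDist
  fun_prop

theorem abs_weightedDist_sub_le (p : ℕ) (ω : ℕ → ℕ) (v : ℕ → ℝ) (x y : ℝ) :
    |weightedDist p ω v x - weightedDist p ω v y|
      ≤ (∑ a ∈ Finset.range p, ω a : ℕ) * |x - y| := by
  rw [weightedDist, weightedDist, ← Finset.sum_sub_distrib]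
  refine (Finset.abs_sum_le_sum_abs _ _).trans ?_
  rw [Nat.cast_sum, Finset.sum_mul]
  refine Finset.sum_le_sum fun a _ => ?_
  rw [← mul_sub, abs_mul, Nat.abs_cast]
  refine mul_le_mul_of_nonneg_left ?_ (Nat.cast_nonneg _)
  simpa using abs_abs_sub_abs_le (x - v a) (y - v a)

theorem abs_weightedDist_sub_le_of_abs_sub_le (p : ℕ) (ω : ℕ → ℕ) (v z : ℕ → ℝ) (ε x : ℝ)
    (h : ∀ a, |v a - z a| ≤ ε) :
    |weightedDist p ω v x - weightedDist p ω z x| ≤ (∑ a ∈ Finset.range p, ω a : ℕ) * ε := by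
  rw [weightedDist, weightedDist, ← Finset.sum_sub_distrib]
  refine (Finset.abs_sum_le_sum_abs _ _).trans ?_
  rw [Nat.cast_sum, Finset.sum_mul]
  refine Finset.sum_le_sum fun a _ => ?_
  rw [← mul_sub, abs_mul, Nat.abs_cast]
  refine mul_le_mul_of_nonneg_left (le_trans ?_ (h a)) (Nat.cast_nonneg _)
  have := abs_abs_sub_abs_le (x - v a) (x - z a)
  rwa [sub_sub_sub_cancel_left, abs_sub_comm (z a)] at this

/-- The points `0, -1, 2, -3, 4, …`. -/
noncomputable def zigzag (a : ℕ) : ℝ := (-1) ^ a * a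

theorem zigzag_zero : zigzag 0 = 0 := by simp [zigzag]

theorem abs_zigzag (a : ℕ) : |zigzag a| = a := by simp [zigzag, abs_mul]

theorem sum_abs_sub_zigzag_le (r : ℕ) (x y : ℝ) (h : |x - 1 / 2| ≤ |y - 1 / 2|) :
    ∑ a ∈ Finset.range (2 * r), |x - zigzag (a + 1)|
      ≤ ∑ a ∈ Finset.range (2 * r), |y - zigzag (a + 1)| := by
  induction r with
  | zero => simp
  | succ r ih =>
    have h1 : zigzag (2 * r + 1) = -(2 * r + 1) := by
      simp [zigzag, pow_succ, pow_mul]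
    have h2 : zigzag (2 * r + 1 + 1) = 2 * r + 2 := by
      simp only [zigzag, pow_succ, pow_mul]; push_cast; norm_num; ring
    rw [show 2 * (r + 1) = 2 * r + 1 + 1 by ring]
    simp only [Finset.sum_range_succ, h1, h2]
    have hr : (0 : ℝ) ≤ r := Nat.cast_nonneg r
    have : |x - -(2 * (r : ℝ) + 1)| + |x - (2 * r + 2)|
        ≤ |y - -(2 * (r : ℝ) + 1)| + |y - (2 * r + 2)| := by
      rcases abs_cases (x - 1 / 2) with hx | hx <;> rcases abs_cases (y - 1 / 2) with hy | hy <;>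
      rcases abs_cases (x - -(2 * (r : ℝ) + 1)) with h3 | h3 <;>
      rcases abs_cases (y - -(2 * (r : ℝ) + 1)) with h4 | h4 <;>
      rcases abs_cases (x - (2 * (r : ℝ) + 2)) with h5 | h5 <;>
      rcases abs_cases (y - (2 * (r : ℝ) + 2)) with h6 | h6 <;> linarith
    linarith

section

variable {r : ℕ} {ω : ℕ → ℕ}

theorem weightedDist_zigzag_add_le (hω : ∀ a, 1 ≤ ω a) (hω' : ∀ a, ω (a + 1) = 1) {a b : ℕ}
    (hab : a ≤ b) :
    weightedDist (2 * r + 1) ω zigzag (zigzag a) + (b - a)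
      ≤ weightedDist (2 * r + 1) ω zigzag (zigzag b) := by
  rcases hab.eq_or_lt with rfl | hlt
  · simp
  have hlt' : (a : ℝ) + 1 ≤ b := by exact_mod_cast hlt
  have h := sum_abs_sub_zigzag_le r (zigzag a) (zigzag b) (by
    have h1 := abs_sub (zigzag a) (1 / 2)
    have h2 := abs_sub_abs_le_abs_sub (zigzag b) (1 / 2)
    rw [abs_zigzag, abs_of_pos (by norm_num : (0 : ℝ) < 1 / 2)] at h1 h2
    linarith)
  have h0 : (1 : ℝ) ≤ ω 0 := by exact_mod_cast hω 0
  simp only [weightedDist, Finset.sum_range_succ', zigzag_zero, sub_zero, abs_zigzag, hω',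
    Nat.cast_one, one_mul]
  nlinarith

theorem weightedDist_zigzag_monotone (hω : ∀ a, 1 ≤ ω a) (hω' : ∀ a, ω (a + 1) = 1) :
    Monotone fun a => weightedDist (2 * r + 1) ω zigzag (zigzag a) := fun a b hab => by
  have h := weightedDist_zigzag_add_le (r := r) hω hω' hab
  have hab' : (a : ℝ) ≤ b := by exact_mod_cast hab
  simp only
  linarith

theorem abs_le_weightedDist_zigzag (hω : ∀ a, 1 ≤ ω a) (x : ℝ) :
    |x| ≤ weightedDist (2 * r + 1) ω zigzag x := by
  have h0 : (1 : ℝ) ≤ ω 0 := by exact_mod_cast hω 0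
  rw [weightedDist, Finset.sum_range_succ', zigzag_zero, sub_zero]
  have : 0 ≤ ∑ a ∈ Finset.range (2 * r), (ω (a + 1) : ℝ) * |x - zigzag (a + 1)| :=
    Finset.sum_nonneg fun a _ => by positivity
  nlinarith [abs_nonneg x]

theorem exists_neg_weightedDist_zigzag_eq (hω : ∀ a, 1 ≤ ω a) (h : ℝ)
    (hh : weightedDist (2 * r + 1) ω zigzag 0 < h) :
    ∃ c < 0, weightedDist (2 * r + 1) ω zigzag c = h := by
  have h0 : 0 ≤ h := ((abs_nonneg _).trans (abs_le_weightedDist_zigzag hω 0)).trans hh.le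
  have h1 := abs_le_weightedDist_zigzag (r := r) hω (-h)
  rw [abs_neg, abs_of_nonneg h0] at h1
  obtain ⟨c, hc, rfl⟩ := intermediate_value_Icc' (neg_nonpos.2 h0)
    (weightedDist_continuous (2 * r + 1) ω zigzag).continuousOn ⟨hh.le, h1⟩
  exact ⟨c, lt_of_le_of_ne hc.2 (by rintro rfl; exact lt_irrefl _ hh), rfl⟩

theorem exists_pos_weightedDist_zigzag_eq (hω : ∀ a, 1 ≤ ω a) (h : ℝ)
    (hh : weightedDist (2 * r + 1) ω zigzag 0 < h) :
    ∃ c > 0, weightedDist (2 * r + 1) ω zigzag c = h := by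
  have h0 : 0 ≤ h := ((abs_nonneg _).trans (abs_le_weightedDist_zigzag hω 0)).trans hh.le
  have h1 := abs_le_weightedDist_zigzag (r := r) hω h
  rw [abs_of_nonneg h0] at h1
  obtain ⟨c, hc, rfl⟩ := intermediate_value_Icc h0
    (weightedDist_continuous (2 * r + 1) ω zigzag).continuousOn ⟨hh.le, h1⟩
  exact ⟨c, lt_of_le_of_ne hc.1 (by rintro rfl; exact lt_irrefl _ hh), rfl⟩

theorem lt_zigzag_iff_of_neg (hω : ∀ a, 1 ≤ ω a) (hω' : ∀ a, ω (a + 1) = 1) {c : ℝ} {i : ℕ}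
    (hc : c < 0) (h1 : weightedDist (2 * r + 1) ω zigzag (zigzag i)
      < weightedDist (2 * r + 1) ω zigzag c)
    (h2 : weightedDist (2 * r + 1) ω zigzag c
      < weightedDist (2 * r + 1) ω zigzag (zigzag (i + 1))) (a : ℕ) :
    c < zigzag a ↔ a ≤ i ∨ 0 < zigzag a := by
  have hmono := weightedDist_zigzag_monotone (r := r) hω hω'
  have hconv := weightedDist_convexOn (2 * r + 1) ω zigzag
  have h0 := hmono (Nat.zero_le i)
  simp only [zigzag_zero] at h0
  constructor
  · intro hlt
    by_contra! hcon
    have := hconv.le_max_of_mem_Icc (Set.mem_univ c) (Set.mem_univ 0) ⟨hlt.le, hcon.2⟩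
    have h3 := hmono (show i + 1 ≤ a from hcon.1)
    simp only at h3
    rcases le_max_iff.1 this with h | h <;> linarith
  · rintro (hai | hpos)
    · by_contra! hcon
      have := hconv.le_max_of_mem_Icc (Set.mem_univ (zigzag a)) (Set.mem_univ 0) ⟨hcon, hc.le⟩
      have h3 := hmono hai
      simp only at h3
      rcases le_max_iff.1 this with h | h <;> linarith
    · exact hc.trans hpos

theorem lt_zigzag_iff_of_pos (hω : ∀ a, 1 ≤ ω a) (hω' : ∀ a, ω (a + 1) = 1) {c : ℝ} {i : ℕ}
    (hc : 0 < c) (h1 : weightedDist (2 * r + 1) ω zigzag (zigzag i)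
      < weightedDist (2 * r + 1) ω zigzag c)
    (h2 : weightedDist (2 * r + 1) ω zigzag c
      < weightedDist (2 * r + 1) ω zigzag (zigzag (i + 1))) (a : ℕ) :
    c < zigzag a ↔ i < a ∧ 0 < zigzag a := by
  have hmono := weightedDist_zigzag_monotone (r := r) hω hω'
  have hconv := weightedDist_convexOn (2 * r + 1) ω zigzag
  have h0 := hmono (Nat.zero_le i)
  simp only [zigzag_zero] at h0
  constructor
  · refine fun hlt => ⟨?_, hc.trans hlt⟩
    by_contra! hcon
    have := hconv.le_max_of_mem_Icc (Set.mem_univ 0) (Set.mem_univ (zigzag a)) ⟨hc.le, hlt.le⟩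
    have h3 := hmono hcon
    simp only at h3
    rcases le_max_iff.1 this with h | h <;> linarith
  · rintro ⟨hia, hpos⟩
    by_contra! hcon
    have := hconv.le_max_of_mem_Icc (Set.mem_univ 0) (Set.mem_univ c) ⟨hpos.le, hcon⟩
    have h3 := hmono (show i + 1 ≤ a from hia)
    simp only at h3
    rcases le_max_iff.1 this with h | h <;> linarith

end

theorem weightedDist_sub_eq_sum_of_abs_sub_lt (p : ℕ) (ω : ℕ → ℕ) (v z : ℕ → ℝ) (c : ℝ)
    (h : ∀ a, |v a - z a| < |c - z a|) :
    weightedDist p ω v c - weightedDist p ω z c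
      = ∑ a ∈ Finset.range p, ω a * (v a - z a) * (if c < z a then 1 else -1) := by
  rw [weightedDist, weightedDist, ← Finset.sum_sub_distrib]
  refine Finset.sum_congr rfl fun a _ => ?_
  have ha := h a
  split_ifs with hlt
  · rw [abs_of_neg (sub_neg.2 hlt)] at ha ⊢
    rw [abs_of_neg (by linarith [(abs_lt.1 ha).1])]
    ring
  · rw [abs_of_nonneg (sub_nonneg.2 (not_lt.1 hlt))] at ha ⊢
    rw [abs_of_pos (by linarith [(abs_lt.1 ha).2])]
    ring

theorem exists_points_and_shifts {r : ℕ} {ω : ℕ → ℕ} (hω : ∀ a, 1 ≤ ω a)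
    (hω' : ∀ a, ω (a + 1) = 1) {N : ℕ} (hN : 1 ≤ N) (m : ℕ) :
    ∃ (P : (Fin (2 * r + 1) × Fin N ⊕ Fin (2 * r + 1) × Fin N) ⊕ Fin m → ℝ)
      (v : (Fin (2 * r + 1) → Fin (N ^ 2)) → ℕ → ℝ),
      (∀ u, Function.Injective fun x => weightedDist (2 * r + 1) ω (v u) (P x)) ∧
      ∀ u u', (∀ x y, weightedDist (2 * r + 1) ω (v u) (P x)
          < weightedDist (2 * r + 1) ω (v u) (P y) →
        weightedDist (2 * r + 1) ω (v u') (P x) < weightedDist (2 * r + 1) ω (v u') (P y)) →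
        u ≤ u' := by
  classical
  set p := 2 * r + 1 with hp
  set K : ℕ := ∑ a ∈ Finset.range p, ω a with hK
  have hKpos : 0 < K := Finset.sum_pos (fun a _ => hω a) ⟨0, by simp [hp]⟩
  have hKpos' : (0 : ℝ) < K := by exact_mod_cast hKpos
  have hK1 : (1 : ℝ) ≤ K := by exact_mod_cast hKpos
  have hNpos : (0 : ℝ) < N := by exact_mod_cast hN
  set D := weightedDist p ω zigzag with hD
  have hstep : ∀ {a b : ℕ}, a ≤ b → D (zigzag a) + (b - a) ≤ D (zigzag b) := fun h =>
    weightedDist_zigzag_add_le hω hω' h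
  have hmono : Monotone fun a => D (zigzag a) := weightedDist_zigzag_monotone hω hω'
  let H : ℕ → ℝ := fun i => D (zigzag i) + 1 / 2
  have hHsep : ∀ {i j : ℕ}, i ≠ j → 1 ≤ |H i - H j| := by
    have : ∀ {i j : ℕ}, i < j → 1 ≤ H j - H i := by
      intro i j hij
      have h1 := hstep hij.le
      have h2 : (i : ℝ) + 1 ≤ j := by exact_mod_cast hij
      simp only [H]
      linarith
    intro i j hij
    rcases lt_or_gt_of_ne hij with h | h
    · rw [abs_sub_comm]
      exact (this h).trans (le_abs_self _)
    · exact (this h).trans (le_abs_self _)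
  have hH0 : ∀ (i : ℕ) (t : ℝ), |t| ≤ 1 / 8 → D 0 < H i + t := by
    intro i t ht
    have h1 := hmono (Nat.zero_le i)
    simp only [zigzag_zero] at h1
    have h2 := (abs_le.1 ht).1
    simp only [H]
    linarith
  choose! Lf hLneg hLeq using exists_neg_weightedDist_zigzag_eq (r := r) hω
  choose! Rf hRpos hReq using exists_pos_weightedDist_zigzag_eq (r := r) hω
  set δ : ℝ := 1 / (8 * K * N ^ 2) with hδ
  have hδpos : 0 < δ := by positivity
  have hδN : δ * N ^ 2 = 1 / (8 * K) := by rw [hδ]; field_simp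
  have hδK : 1 / (8 * (K : ℝ)) ≤ 1 / 8 := by
    apply one_div_le_one_div_of_le <;> linarith
  have hfin : ∀ j : Fin N, (j : ℝ) + 1 ≤ N := fun j => by exact_mod_cast j.2
  have hlL : ∀ l : Fin N, |-(δ * l)| ≤ 1 / 8 := by
    intro l
    rw [abs_neg, abs_of_nonneg (by positivity)]
    have h1 : (l : ℝ) ≤ N ^ 2 := by nlinarith [hfin l, (Nat.cast_nonneg l : (0 : ℝ) ≤ (l : ℕ))]
    nlinarith
  have hlR : ∀ j : Fin N, |δ * (N * j)| ≤ 1 / 8 := by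
    intro j
    rw [abs_of_nonneg (by positivity)]
    have h1 : N * (j : ℝ) ≤ N ^ 2 := by nlinarith [hfin j]
    nlinarith
  let P : (Fin p × Fin N ⊕ Fin p × Fin N) ⊕ Fin m → ℝ := Sum.elim
    (Sum.elim (fun x => Lf (H x.1 + -(δ * x.2))) (fun x => Rf (H x.1 + δ * (N * x.2))))
    (fun j => Rf (H (p + j) + 0))
  let T : (Fin p → Fin (N ^ 2)) → ℕ → ℝ := fun u i =>
    Nat.casesOn i 0 fun i => if h : i < p then ((u ⟨i, h⟩ : ℕ) : ℝ) + 1 / 2 else 0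
  have hT0 : ∀ u, T u 0 = 0 := fun u => rfl
  have hTs : ∀ u (i : Fin p), T u (i + 1) = ((u i : ℕ) : ℝ) + 1 / 2 := fun u i => by simp [T]
  have hTmem : ∀ u i, 0 ≤ T u i ∧ T u i ≤ N ^ 2 := by
    intro u i
    cases i with
    | zero => simp [hT0]
    | succ i =>
      by_cases h : i < p
      · have h1 : ((u ⟨i, h⟩ : ℕ) : ℝ) + 1 ≤ N ^ 2 := by exact_mod_cast (u ⟨i, h⟩).2
        rw [hTs u ⟨i, h⟩]
        constructor
        · positivity
        · linarith
      · simp [T, h]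
  let v : (Fin p → Fin (N ^ 2)) → ℕ → ℝ := fun u a =>
    zigzag a + δ * (T u (a + 1) - T u a) / (2 * ω a)
  have hvw : ∀ u a, ω a * (v u a - zigzag a) = δ / 2 * (T u (a + 1) - T u a) := by
    intro u a
    have : (ω a : ℝ) ≠ 0 := by exact_mod_cast Nat.ne_of_gt (hω a)
    simp only [v]
    field_simp
    ring
  have hvz : ∀ u a, |v u a - zigzag a| ≤ 1 / (8 * K) := by
    intro u a
    have h1 : (1 : ℝ) ≤ ω a := by exact_mod_cast hω a
    have h2 : |v u a - zigzag a| ≤ ω a * |v u a - zigzag a| :=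
      le_mul_of_one_le_left (abs_nonneg _) h1
    have h3 : (ω a : ℝ) * |v u a - zigzag a| = |δ / 2 * (T u (a + 1) - T u a)| := by
      rw [← hvw, abs_mul, Nat.abs_cast]
    have h4 : |T u (a + 1) - T u a| ≤ N ^ 2 := by
      rw [abs_le]
      constructor <;> linarith [(hTmem u (a + 1)).1, (hTmem u (a + 1)).2, (hTmem u a).1,
        (hTmem u a).2]
    rw [abs_mul, abs_of_pos (half_pos hδpos)] at h3
    nlinarith
  have hnear : ∀ u c, |weightedDist p ω (v u) c - D c| ≤ 1 / 8 := by
    intro u c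
    have := abs_weightedDist_sub_le_of_abs_sub_le p ω (v u) zigzag _ c (hvz u)
    rwa [← hK, show (K : ℝ) * (1 / (8 * K)) = 1 / 8 by field_simp] at this
  have hfar : ∀ (i : ℕ) (c t : ℝ), |t| ≤ 1 / 8 → D c = H i + t → ∀ u a,
      |v u a - zigzag a| < |c - zigzag a| := by
    intro i c t ht hc u a
    refine (hvz u a).trans_lt ?_
    have h1 : 3 / 8 ≤ |D c - D (zigzag a)| := by
      obtain ⟨h2, h3⟩ := abs_le.1 ht
      rw [hc]
      rcases le_or_gt a i with h | h
      · have h4 := hmono h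
        simp only at h4
        refine le_trans ?_ (le_abs_self _)
        simp only [H]
        linarith
      · have h4 := hstep h.le
        have h5 : (i : ℝ) + 1 ≤ a := by exact_mod_cast h
        rw [abs_sub_comm]
        refine le_trans ?_ (le_abs_self _)
        simp only [H]
        linarith
    have h2 := h1.trans (abs_weightedDist_sub_le p ω zigzag c (zigzag a))
    rw [← hK] at h2
    rw [div_lt_iff₀ (by positivity)]
    linarith
  have hbetween : ∀ (i : ℕ) (c t : ℝ), |t| ≤ 1 / 8 → D c = H i + t →
      D (zigzag i) < D c ∧ D c < D (zigzag (i + 1)) := by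
    intro i c t ht hc
    obtain ⟨h2, h3⟩ := abs_le.1 ht
    have h4 := hstep (Nat.le_succ i)
    push_cast at h4
    rw [hc]
    simp only [H]
    constructor <;> linarith
  let SL : (Fin p → Fin (N ^ 2)) → Fin p → ℝ := fun u i => ∑ a ∈ Finset.range p,
    ω a * (v u a - zigzag a) * (if a ≤ (i : ℕ) ∨ 0 < zigzag a then 1 else -1)
  let SR : (Fin p → Fin (N ^ 2)) → Fin p → ℝ := fun u i => ∑ a ∈ Finset.range p,
    ω a * (v u a - zigzag a) * (if (i : ℕ) < a ∧ 0 < zigzag a then 1 else -1)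
  have hL : ∀ u (i : Fin p) (l : Fin N), weightedDist p ω (v u) (P (Sum.inl (Sum.inl (i, l))))
      = H i - δ * l + SL u i := by
    intro u i l
    have hlev := hH0 i _ (hlL l)
    have hc := hLeq _ hlev
    have h1 := weightedDist_sub_eq_sum_of_abs_sub_lt p ω (v u) zigzag _
      (hfar i _ _ (hlL l) hc u)
    obtain ⟨h2, h3⟩ := hbetween i _ _ (hlL l) hc
    simp only [lt_zigzag_iff_of_neg hω hω' (hLneg _ hlev) h2 h3] at h1
    simp only [P, Sum.elim_inl]
    simp only [SL]
    linarith
  have hR : ∀ u (i : Fin p) (j : Fin N), weightedDist p ω (v u) (P (Sum.inl (Sum.inr (i, j))))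
      = H i + δ * (N * j) + SR u i := by
    intro u i l
    have hlev := hH0 i _ (hlR l)
    have hc := hReq _ hlev
    have h1 := weightedDist_sub_eq_sum_of_abs_sub_lt p ω (v u) zigzag _
      (hfar i _ _ (hlR l) hc u)
    obtain ⟨h2, h3⟩ := hbetween i _ _ (hlR l) hc
    simp only [lt_zigzag_iff_of_pos hω hω' (hRpos _ hlev) h2 h3] at h1
    simp only [P, Sum.elim_inl, Sum.elim_inr]
    simp only [SR]
    linarith
  have hS : ∀ u i, SR u i - SL u i = -(δ * (((u i : ℕ) : ℝ) + 1 / 2)) := by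
    intro u i
    have h1 : ∑ a ∈ Finset.range (i + 1), (T u (a + 1) - T u a) = ((u i : ℕ) : ℝ) + 1 / 2 := by
      rw [Finset.sum_range_sub, hT0, hTs, sub_zero]
    have h2 : SR u i - SL u i
        = ∑ a ∈ Finset.range p, if a ∈ Finset.range (i + 1) then -δ * (T u (a + 1) - T u a)
          else 0 := by
      simp only [SR, SL]
      rw [← Finset.sum_sub_distrib]
      refine Finset.sum_congr rfl fun a _ => ?_
      simp only [hvw, Finset.mem_range, Nat.lt_succ_iff]
      rcases le_or_gt a i with h | h
      · simp only [h, h.not_gt, true_or, false_and, if_true, if_false]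
        ring
      · simp only [h, h.not_ge, false_or, true_and, if_false, sub_self]
    rw [h2, Finset.sum_ite_mem, Finset.inter_eq_right.2
      (Finset.range_subset_range.2 (Nat.succ_le_of_lt i.2)), ← Finset.mul_sum, h1]
    ring
  have hdiff : ∀ u i l j, weightedDist p ω (v u) (P (Sum.inl (Sum.inr (i, j))))
      - weightedDist p ω (v u) (P (Sum.inl (Sum.inl (i, l))))
      = δ * (((N * j + l : ℕ) : ℝ) - (((u i : ℕ) : ℝ) + 1 / 2)) := by
    intro u i l j
    rw [hL, hR]
    push_cast
    linarith [hS u i]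
  have hlt_iff : ∀ u i l j, weightedDist p ω (v u) (P (Sum.inl (Sum.inr (i, j))))
      < weightedDist p ω (v u) (P (Sum.inl (Sum.inl (i, l)))) ↔
        N * (j : ℕ) + l ≤ (u i : ℕ) := by
    intro u i l j
    rw [← sub_neg, hdiff, ← mul_zero δ, mul_lt_mul_iff_right₀ hδpos]
    constructor
    · intro h
      have : ((N * j + l : ℕ) : ℝ) < ((u i + 1 : ℕ) : ℝ) := by
        push_cast at h ⊢
        linarith
      exact Nat.lt_succ_iff.1 (by exact_mod_cast this)
    · intro h
      have : ((N * j + l : ℕ) : ℝ) ≤ ((u i : ℕ) : ℝ) := by exact_mod_cast h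
      linarith
  have hne : ∀ u i l j, weightedDist p ω (v u) (P (Sum.inl (Sum.inr (i, j))))
      ≠ weightedDist p ω (v u) (P (Sum.inl (Sum.inl (i, l)))) := by
    intro u i l j h
    rw [← sub_eq_zero, hdiff, mul_eq_zero, or_iff_right hδpos.ne'] at h
    have h' : ((2 * (N * j + l) : ℕ) : ℝ) = ((2 * (u i : ℕ) + 1 : ℕ) : ℝ) := by
      push_cast at h ⊢
      linarith
    have h'' : 2 * (N * (j : ℕ) + l) = 2 * (u i : ℕ) + 1 := by exact_mod_cast h'
    omega
  let idx : (Fin p × Fin N ⊕ Fin p × Fin N) ⊕ Fin m → ℕ := Sum.elim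
    (Sum.elim (fun x => x.1) (fun x => x.1)) (fun j => p + j)
  have hidx : ∀ u x, |weightedDist p ω (v u) (P x) - H (idx x)| ≤ 1 / 4 := by
    intro u x
    have hDP : |D (P x) - H (idx x)| ≤ 1 / 8 := by
      rcases x with (⟨i, l⟩ | ⟨i, j⟩) | j
      · simp only [P, idx, Sum.elim_inl]
        rw [hD, hLeq _ (hH0 i _ (hlL l)), add_sub_cancel_left]
        exact hlL l
      · simp only [P, idx, Sum.elim_inl, Sum.elim_inr]
        rw [hD, hReq _ (hH0 i _ (hlR j)), add_sub_cancel_left]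
        exact hlR j
      · simp only [P, idx, Sum.elim_inr]
        rw [hD, hReq _ (hH0 (p + j) 0 (by norm_num)), add_sub_cancel_left]
        norm_num
    have := abs_sub_le (weightedDist p ω (v u) (P x)) (D (P x)) (H (idx x))
    linarith [hnear u (P x)]
  refine ⟨P, v, fun u x y hxy => ?_, fun u u' h => ?_⟩
  · have hxy' : weightedDist p ω (v u) (P x) = weightedDist p ω (v u) (P y) := hxy
    have hidx_eq : idx x = idx y := by
      by_contra hcon
      have h1 := hHsep hcon
      have h2 := abs_sub_le (H (idx x)) (weightedDist p ω (v u) (P x)) (H (idx y))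
      have h3 := hidx u x
      have h4 := hidx u y
      rw [abs_sub_comm] at h3
      rw [← hxy'] at h4
      linarith
    rcases x with (⟨i, l⟩ | ⟨i, l⟩) | l <;> rcases y with (⟨i', l'⟩ | ⟨i', l'⟩) | l' <;>
      simp only [idx, Sum.elim_inl, Sum.elim_inr] at hidx_eq
    · obtain rfl := Fin.ext hidx_eq
      rw [hL, hL] at hxy'
      have h1 : δ * l = δ * l' := by linarith
      have h2 : (l : ℕ) = l' := by exact_mod_cast mul_left_cancel₀ hδpos.ne' h1
      rw [Fin.ext h2]
    · obtain rfl := Fin.ext hidx_eq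
      exact absurd hxy'.symm (hne u i l l')
    · omega
    · obtain rfl := Fin.ext hidx_eq
      exact absurd hxy' (hne u i l' l)
    · obtain rfl := Fin.ext hidx_eq
      rw [hR, hR] at hxy'
      have h1 : δ * (N * l) = δ * (N * l') := by linarith
      have h2 : (l : ℕ) = l' := by
        exact_mod_cast mul_left_cancel₀ hNpos.ne' (mul_left_cancel₀ hδpos.ne' h1)
      rw [Fin.ext h2]
    · omega
    · omega
    · omega
    · rw [Fin.ext (Nat.add_left_cancel hidx_eq)]
  · intro i
    have hlt : (u i : ℕ) < N * N := (u i).2.trans_eq (sq N)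
    have h1 := h _ _ ((hlt_iff u i ⟨u i % N, Nat.mod_lt _ hN⟩
      ⟨u i / N, Nat.div_lt_of_lt_mul hlt⟩).2 (Nat.div_add_mod _ _).le)
    have h2 := (hlt_iff u' i _ _).1 h1
    exact Fin.le_def.2 (by simpa only [Nat.div_add_mod] using h2)

theorem Finset.exists_strictMono_comp {α : Type*} (C : Finset α) (f : α → ℝ)
    (hf : Set.InjOn f C) :
    ∃ σ : Fin C.card → α, (∀ i, σ i ∈ C) ∧ StrictMono fun i => f (σ i) := by
  classical
  have hcard : (C.image f).card = C.card := Finset.card_image_of_injOn hf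
  have h : ∀ i, ∃ c ∈ C, f c = (C.image f).orderEmbOfFin hcard i := fun i =>
    Finset.mem_image.1 (Finset.orderEmbOfFin_mem _ hcard i)
  choose σ hσ hσ' using h
  exact ⟨σ, hσ, by simpa only [hσ'] using ((C.image f).orderEmbOfFin hcard).strictMono⟩

theorem exists_le_psiCount {k r : ℕ} (hk : k = 2 * r + 1 ∨ k = 2 * r + 2) {N : ℕ} (hN : 1 ≤ N)
    (m : ℕ) :
    ∃ C : Finset (EuclideanSpace ℝ (Fin 1)), C.card = 2 * ((2 * r + 1) * N) + m ∧
      (N ^ 2) ^ (2 * r + 1) ≤ psiCount k C := by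
  classical
  set p := 2 * r + 1 with hp
  let ω := medianWeight k r
  have hω : ∀ a, 1 ≤ ω a := by
    intro a
    simp only [ω, medianWeight]
    split_ifs <;> omega
  have hω' : ∀ a, ω (a + 1) = 1 := fun a => by simp [ω, medianWeight]
  have hωsum : ∑ a ∈ Finset.range p, ω a = k := by
    rw [hp, Finset.sum_range_succ']
    simp only [hω', Finset.sum_const, Finset.card_range, smul_eq_mul, ω, medianWeight, if_true]
    omega
  obtain ⟨P, v, hinj, hord⟩ := exists_points_and_shifts hω hω' hN m (r := r)
  let pt : ℝ → EuclideanSpace ℝ (Fin 1) := fun x => !₂[x]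
  have hpt : ∀ x, pt x 0 = x := fun x => rfl
  have hN2 : 0 < N ^ 2 := pow_pos hN 2
  have hPinj : Function.Injective fun x => pt (P x) := by
    intro x y hxy
    refine hinj (fun _ => ⟨0, hN2⟩) ?_
    have : pt (P x) 0 = pt (P y) 0 := congrArg (fun c : EuclideanSpace ℝ (Fin 1) => c 0) hxy
    rw [hpt, hpt] at this
    simp only [this]
  let C : Finset (EuclideanSpace ℝ (Fin 1)) := Finset.univ.map ⟨_, hPinj⟩
  have hCmem : ∀ x, pt (P x) ∈ C := fun x => Finset.mem_map_of_mem ⟨_, hPinj⟩ (Finset.mem_univ x)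
  have hCard : C.card = 2 * (p * N) + m := by
    simp only [C, Finset.card_map, Finset.card_univ, Fintype.card_sum, Fintype.card_prod,
      Fintype.card_fin]
    ring
  let V : (Fin p → Fin (N ^ 2)) → Multiset (EuclideanSpace ℝ (Fin 1)) := fun u =>
    ∑ a ∈ Finset.range p, Multiset.replicate (ω a) (pt (v u a))
  have hVcard : ∀ u, Multiset.card (V u) = k := fun u => by simp [V, hωsum]
  have hVdist : ∀ u c, sumDist (V u) c = weightedDist p ω (v u) (c 0) := by
    intro u c
    have h : ∀ s : Finset ℕ, sumDist (∑ a ∈ s, Multiset.replicate (ω a) (pt (v u a))) c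
        = ∑ a ∈ s, ω a * |c 0 - v u a| := by
      intro s
      induction s using Finset.induction_on with
      | empty => simp [sumDist]
      | insert a s ha ih =>
        rw [Finset.sum_insert ha, Finset.sum_insert ha, ← ih]
        simp [sumDist, dist_eq_abs_apply_zero, hpt]
    exact h _
  have hVinj : ∀ u, Set.InjOn (sumDist (V u)) C := by
    intro u x hx y hy hxy
    obtain ⟨x, -, rfl⟩ := Finset.mem_map.1 (Finset.mem_coe.1 hx)
    obtain ⟨y, -, rfl⟩ := Finset.mem_map.1 (Finset.mem_coe.1 hy)
    rw [hVdist, hVdist] at hxy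
    rw [hinj u hxy]
  have hex := fun u => C.exists_strictMono_comp _ (hVinj u)
  choose σ hσC hσmono using hex
  have hσinj : ∀ u, Function.Injective (σ u) := fun u i j hij =>
    (hσmono u).injective (congrArg (sumDist (V u)) hij)
  have hle : ∀ u u', σ u = σ u' → u ≤ u' := by
    intro u u' huu
    refine hord u u' fun x y hxy => ?_
    obtain ⟨i, hi⟩ := (hσinj u).exists_eq_of_mem_finset (hσC u) (hCmem x)
    obtain ⟨j, hj⟩ := (hσinj u).exists_eq_of_mem_finset (hσC u) (hCmem y)
    have h1 := (hσmono u).lt_iff_lt (a := i) (b := j)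
    have h2 := (hσmono u').lt_iff_lt (a := i) (b := j)
    simp only [← huu, hi, hj, hVdist, hpt] at h1 h2
    exact h2.2 (h1.1 hxy)
  have hfinite : Finite (PsiSet k C.card C) := (psiSet_finite k C.card C).to_subtype
  refine ⟨C, hCard, ?_⟩
  calc (N ^ 2) ^ p = Nat.card (Fin p → Fin (N ^ 2)) := by simp
    _ ≤ psiCount k C := Nat.card_le_card_of_injective
        (fun u => (⟨σ u, hσinj u, hσC u, V u, hVcard u, hVinj u, hσmono u⟩ : PsiSet k C.card C))
        fun u u' h => le_antisymm (hle u u' (congrArg Subtype.val h))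
          (hle u' u (congrArg Subtype.val h).symm)

/-- For fixed `k ≥ 1`, `ψ^max_{1,k}(n) = Θ_k(n^{4⌈k/2⌉−2})`.
Here `⌈k/2⌉ = (k+1)/2` in natural-number division. -/
theorem psiMax_one_isTheta (k : ℕ) (hk : 1 ≤ k) :
    ∃ c₁ c₂ : ℝ, 0 < c₁ ∧ 0 < c₂ ∧ ∃ N : ℕ, ∀ n : ℕ, N ≤ n →
      c₁ * (n : ℝ) ^ (4 * ((k + 1) / 2) - 2) ≤ (psiMax 1 k n : ℝ) ∧
      (psiMax 1 k n : ℝ) ≤ c₂ * (n : ℝ) ^ (4 * ((k + 1) / 2) - 2) := by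
  obtain ⟨r, hr⟩ : ∃ r, k = 2 * r + 1 ∨ k = 2 * r + 2 := ⟨(k - 1) / 2, by omega⟩
  have hexp : 4 * ((k + 1) / 2) - 2 = 2 * (2 * r + 1) := by omega
  rw [hexp]
  set p := 2 * r + 1 with hp
  set B : ℕ := (p + 1) * (p + 4 ^ p) ^ p with hB
  have hub : ∀ n, 1 ≤ n →
      B * n ^ (2 * p) ∈ upperBounds {m | ∃ C : Finset (EuclideanSpace ℝ (Fin 1)),
        C.card = n ∧ psiCount k C = m} := by
    rintro n hn _ ⟨C, rfl, rfl⟩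
    refine (psiCount_le hr C (Finset.card_pos.1 hn)).trans_eq ?_
    rw [← hp, show 2 * r + 2 = p + 1 by omega, hB, mul_pow, pow_mul, mul_assoc]
  refine ⟨(1 / (4 * p : ℝ)) ^ (2 * p), B, by positivity, by positivity, 2 * p, fun n hn => ⟨?_, ?_⟩⟩
  · set N := n / (2 * p) with hNdef
    have hppos : 0 < 2 * p := by omega
    have hN : 1 ≤ N := (Nat.one_le_div_iff hppos).2 hn
    obtain ⟨C, hC, hCle⟩ := exists_le_psiCount hr hN (n % (2 * p))
    rw [← hp, ← mul_assoc, hNdef, Nat.div_add_mod] at hC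
    have hle : (N ^ 2) ^ p ≤ psiMax 1 k n :=
      hCle.trans (le_csSup ⟨_, hub n (by omega)⟩ ⟨C, hC, rfl⟩)
    have hnN : n ≤ 4 * p * N := by
      have h1 := Nat.div_add_mod n (2 * p)
      have h2 := Nat.mod_lt n hppos
      rw [← hNdef] at h1
      nlinarith
    have hnN' : (n : ℝ) ≤ 4 * p * N := by exact_mod_cast hnN
    have hp0 : (0 : ℝ) < 4 * p := by positivity
    calc (1 / (4 * p : ℝ)) ^ (2 * p) * (n : ℝ) ^ (2 * p)
        = (n / (4 * p : ℝ)) ^ (2 * p) := by rw [← mul_pow]; ring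
      _ ≤ (N : ℝ) ^ (2 * p) := by
        refine pow_le_pow_left₀ (by positivity) ?_ _
        rw [div_le_iff₀ hp0]
        linarith
      _ = (((N ^ 2) ^ p : ℕ) : ℝ) := by push_cast; rw [pow_mul]
      _ ≤ psiMax 1 k n := by exact_mod_cast hle
  · have h : psiMax 1 k n ≤ B * n ^ (2 * p) := csSup_le' (hub n (by omega))
    exact_mod_cast h
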